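/- Let k ≥ 2, let (ψ_i)_{i≥0} be a k-automatic sequence of permutations ψ_i : Δ → Δ of a finite totally ordered alphabet Δ, and let a = (a_n)_{n≥0} be a k-automatic sequence over Δ. Define the modified order on sequences by comparing (x_n) and (y_n) via the ordinary lexicographic comparison of (ψ_n(x_n)) and (ψ_n(y_n)). Then the least sequence in the orbit closure of a with respect to this modified order is k-automatic. -/

import Mathlib

/-- Lexicographic order on infinite sequences over a linearly ordered
alphabet: `x ≤ y` iff `x = y` or `x` and `y` agree before some position `n`
and `x n < y n`. -/
def SeqLexLe {Δ : Type*} [LinearOrder Δ] (x y : ℕ → Δ) : Prop :=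
  x = y ∨ ∃ n : ℕ, (∀ m : ℕ, m < n → x m = y m) ∧ x n < y n

/-- `b` lies in the orbit closure of `a`: every finite prefix of `b` is a
factor of `a`. -/
def InOrbitClosure {Δ : Type*} (a b : ℕ → Δ) : Prop :=
  ∀ n : ℕ, ∃ i : ℕ, ∀ m : ℕ, m < n → b m = a (i + m)

/-- `a` is a `k`-automatic sequence: there is a DFAO (finite state set `Fin n`,
transition `δ`, initial state `q0`, output `τ`) which, on every base-`k`
representation of `m` read least significant digit first (i.e. on `w^R`,
possibly with leading zeros in `w`), outputs `a m`. -/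
def IsKAutomatic (k : ℕ) {Δ : Type*} (a : ℕ → Δ) : Prop :=
  ∃ (n : ℕ) (δ : Fin n → Fin k → Fin n) (q0 : Fin n) (τ : Fin n → Δ),
    ∀ (m : ℕ) (w : List (Fin k)),
      Nat.ofDigits k (w.map Fin.val) = m → a m = τ (w.foldl δ q0)

/-- The order on sequences modified by a sequence of permutations `ψ`:
`x ≤ y` iff `(ψ n (x n))ₙ` is lexicographically at most `(ψ n (y n))ₙ`. -/
def PermSeqLexLe {Δ : Type*} [LinearOrder Δ] (ψ : ℕ → Equiv.Perm Δ)
    (x y : ℕ → Δ) : Prop :=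
  SeqLexLe (fun n => ψ n (x n)) (fun n => ψ n (y n))

/-- `f` takes finitely many forms under repeated substitution of the maps `act d`. For the maps
`x ↦ k * x + d` this says that the `k`-kernel of `f` is finite. -/
def HasFiniteKernel {D X α : Type*} (act : D → X → X) (f : X → α) : Prop :=
  ∃ F : Set (X → α), F.Finite ∧ f ∈ F ∧ ∀ g ∈ F, ∀ d, (fun x => g (act d x)) ∈ F

namespace HasFiniteKernel

variable {D E X Y α β γ : Type*} {act : D → X → X}

theorem map {f : X → α} (hf : HasFiniteKernel act f) (φ : α → β) :
    HasFiniteKernel act fun x => φ (f x) := by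
  obtain ⟨F, hF, hfF, hclosed⟩ := hf
  refine ⟨(fun g x => φ (g x)) '' F, hF.image _, ⟨f, hfF, rfl⟩, ?_⟩
  rintro _ ⟨g, hg, rfl⟩ d
  exact ⟨_, hclosed g hg d, rfl⟩

theorem map₂ {f : X → α} {g : X → β} (hf : HasFiniteKernel act f) (hg : HasFiniteKernel act g)
    (φ : α → β → γ) : HasFiniteKernel act fun x => φ (f x) (g x) := by
  obtain ⟨F, hF, hfF, hFclosed⟩ := hf
  obtain ⟨G, hG, hgG, hGclosed⟩ := hg
  refine ⟨Set.image2 (fun u v x => φ (u x) (v x)) F G, hF.image2 _ hG,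
    ⟨f, hfF, g, hgG, rfl⟩, ?_⟩
  rintro _ ⟨u, hu, v, hv, rfl⟩ d
  exact ⟨_, hFclosed u hu d, _, hGclosed v hv d, rfl⟩

theorem comp_semiconj {f : X → α} (hf : HasFiniteKernel act f) {act' : E → Y → Y} (π : Y → X)
    (σ : E → D) (hπ : ∀ e y, π (act' e y) = act (σ e) (π y)) :
    HasFiniteKernel act' fun y => f (π y) := by
  obtain ⟨F, hF, hfF, hclosed⟩ := hf
  refine ⟨(fun g y => g (π y)) '' F, hF.image _, ⟨f, hfF, rfl⟩, ?_⟩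
  rintro _ ⟨g, hg, rfl⟩ e
  exact ⟨_, hclosed g hg (σ e), by simp only [hπ]⟩

theorem of_fibers [Finite α] {f : X → α} (h : ∀ c, HasFiniteKernel act fun x => f x = c) :
    HasFiniteKernel act f := by
  choose F hF hfF hclosed using h
  refine ⟨{g | ∀ c, (fun x => g x = c) ∈ F c}, ?_, hfF, fun g hg d c => hclosed c _ (hg c) d⟩
  have hinj : Function.Injective fun (g : X → α) (c : α) (x : X) => g x = c := by
    intro g g' h
    funext x
    exact ((congrFun (congrFun h (g' x)) x).mpr rfl)
  refine ((Set.Finite.pi' hF).preimage hinj.injOn).subset ?_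
  intro g hg
  exact hg

end HasFiniteKernel

/-- Prepending the least significant digit `d` in base `k`. -/
def digitStep (k : ℕ) (d : Fin k) (x : ℕ) : ℕ := k * x + d

/-- Prepending least significant digits in base `k` to every entry of a tuple. -/
def tupleStep (k : ℕ) {ι : Type*} (d : ι → Fin k) (x : ι → ℕ) : ι → ℕ :=
  fun i => digitStep k (d i) (x i)

theorem exists_digitStep_eq {k : ℕ} (hk : 0 < k) (y : ℕ) :
    ∃ (e : Fin k) (y' : ℕ), digitStep k e y' = y :=
  ⟨⟨y % k, Nat.mod_lt y hk⟩, y / k, Nat.div_add_mod y k⟩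

theorem ofDigits_map_val_cons {k : ℕ} (d : Fin k) (w : List (Fin k)) :
    Nat.ofDigits k ((d :: w).map Fin.val) =
      digitStep k d (Nat.ofDigits k (w.map Fin.val)) := by
  simp [Nat.ofDigits_cons, digitStep, add_comm]

theorem exists_ofDigits_map_val_eq {k : ℕ} (hk : 2 ≤ k) (m : ℕ) :
    ∃ w : List (Fin k), Nat.ofDigits k (w.map Fin.val) = m := by
  induction m using Nat.strong_induction_on with
  | _ m ih =>
    rcases Nat.eq_zero_or_pos m with rfl | hm
    · exact ⟨[], rfl⟩
    · obtain ⟨w, hw⟩ := ih (m / k) (Nat.div_lt_self hm hk)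
      refine ⟨⟨m % k, Nat.mod_lt m (by omega)⟩ :: w, ?_⟩
      rw [ofDigits_map_val_cons, hw]
      exact Nat.div_add_mod m k

theorem IsKAutomatic.hasFiniteKernel {k : ℕ} (hk : 2 ≤ k) {Δ : Type*} {a : ℕ → Δ}
    (ha : IsKAutomatic k a) : HasFiniteKernel (digitStep k) a := by
  obtain ⟨n, δ, q0, τ, h⟩ := ha
  choose rep hrep using exists_ofDigits_map_val_eq hk
  refine ⟨{g | ∃ q, ∀ w : List (Fin k),
    g (Nat.ofDigits k (w.map Fin.val)) = τ (w.foldl δ q)}, ?_, ⟨q0, fun w => h _ w rfl⟩, ?_⟩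
  · refine (Set.finite_range fun q m => τ ((rep m).foldl δ q)).subset ?_
    rintro g ⟨q, hq⟩
    refine ⟨q, funext fun m => ?_⟩
    simp only [← hq, hrep]
  · rintro g ⟨q, hq⟩ d
    refine ⟨δ q d, fun w => ?_⟩
    simp only [← ofDigits_map_val_cons, hq, List.foldl_cons]

theorem HasFiniteKernel.isKAutomatic {k : ℕ} {Δ : Type*} {a : ℕ → Δ}
    (ha : HasFiniteKernel (digitStep k) a) : IsKAutomatic k a := by
  obtain ⟨F, hF, haF, hclosed⟩ := ha
  have : Finite F := hF
  obtain ⟨n, ⟨e⟩⟩ := Finite.exists_equiv_fin F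
  let step : F → Fin k → F := fun g d => ⟨fun x => g.1 (digitStep k d x), hclosed g.1 g.2 d⟩
  have key : ∀ (w : List (Fin k)) (g : F),
      g.1 (Nat.ofDigits k (w.map Fin.val)) =
        (e.symm (w.foldl (fun q d => e (step (e.symm q) d)) (e g))).1 0 := by
    intro w
    induction w with
    | nil => intro g; simp
    | cons d w ih =>
      intro g
      rw [ofDigits_map_val_cons, List.foldl_cons, e.symm_apply_apply, ← ih]
  refine ⟨n, fun q d => e (step (e.symm q) d), e ⟨a, haF⟩, fun q => (e.symm q).1 0, ?_⟩
  rintro m w rfl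
  exact key w ⟨a, haF⟩

section Tuples

variable {ι α : Type*} {k : ℕ}

theorem HasFiniteKernel.apply_coord {f : ℕ → α} (hf : HasFiniteKernel (digitStep k) f) (i : ι) :
    HasFiniteKernel (tupleStep k) fun x : ι → ℕ => f (x i) :=
  hf.comp_semiconj (fun x : ι → ℕ => x i) (fun d : ι → Fin k => d i) fun _ _ => rfl

theorem HasFiniteKernel.apply_add {f : ℕ → α} (hf : HasFiniteKernel (digitStep k) f) (i j : ι) :
    HasFiniteKernel (tupleStep k) fun x : ι → ℕ => f (x i + x j) := by
  obtain ⟨F, hF, hfF, hclosed⟩ := hf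
  refine ⟨Set.image2 (fun g c x => g (x i + x j + c)) F (Set.Iio 2),
    hF.image2 _ (Set.finite_Iio 2), ⟨f, hfF, 0, by simp, rfl⟩, ?_⟩
  rintro _ ⟨g, hg, c, hc, rfl⟩ d
  have hc : c < 2 := hc
  have hi := (d i).isLt
  have hj := (d j).isLt
  have hpos : 0 < k := by omega
  refine ⟨_, hclosed g hg ⟨(d i + d j + c) % k, Nat.mod_lt _ hpos⟩, (d i + d j + c) / k,
    (Nat.div_lt_iff_lt_mul hpos).mpr (by omega), ?_⟩
  funext x
  simp only [digitStep, tupleStep]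
  congr 1
  have := Nat.div_add_mod (d i + d j + c : ℕ) k
  rw [mul_add, mul_add]
  omega

theorem digitStep_lt_digitStep (d e : Fin k) (x y : ℕ) :
    digitStep k d x < digitStep k e y ↔ if d < e then x ≤ y else x < y := by
  have hd := d.isLt
  have he := e.isLt
  simp only [digitStep, Fin.lt_def]
  rcases lt_trichotomy x y with h | rfl | h
  · have : k * (x + 1) ≤ k * y := Nat.mul_le_mul_left k h
    rw [mul_add] at this
    split_ifs <;> simp only [h, h.le, iff_true] <;> omega
  · split_ifs <;> simp <;> omega
  · have : k * (y + 1) ≤ k * x := Nat.mul_le_mul_left k h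
    rw [mul_add] at this
    split_ifs <;> simp only [not_lt.mpr h.le, not_le.mpr h, iff_false] <;> omega

theorem digitStep_le_digitStep (d e : Fin k) (x y : ℕ) :
    digitStep k d x ≤ digitStep k e y ↔ if d ≤ e then x ≤ y else x < y := by
  rw [← not_lt, digitStep_lt_digitStep]
  split_ifs with h₁ h₂ h₂
  · exact absurd h₁ (not_lt.mpr h₂)
  · exact not_le
  · exact not_lt
  · exact absurd (not_lt.mp h₁) h₂

theorem finite_lt_le_pair (i j : ι) :
    ({fun x => x i < x j, fun x => x i ≤ x j} : Set ((ι → ℕ) → Prop)).Finite :=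
  Set.toFinite _

theorem tupleStep_mem_lt_le_pair (i j : ι) (g : (ι → ℕ) → Prop)
    (hg : g ∈ ({fun x => x i < x j, fun x => x i ≤ x j} : Set ((ι → ℕ) → Prop)))
    (d : ι → Fin k) : (fun x => g (tupleStep k d x)) ∈
      ({fun x => x i < x j, fun x => x i ≤ x j} : Set ((ι → ℕ) → Prop)) := by
  rcases hg with rfl | rfl
  · simp only [tupleStep, digitStep_lt_digitStep]
    split_ifs <;> simp
  · simp only [tupleStep, digitStep_le_digitStep]
    split_ifs <;> simp

theorem hasFiniteKernel_lt (i j : ι) :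
    HasFiniteKernel (tupleStep k) fun x : ι → ℕ => x i < x j :=
  ⟨_, finite_lt_le_pair i j, by simp, tupleStep_mem_lt_le_pair i j⟩

theorem hasFiniteKernel_le (i j : ι) :
    HasFiniteKernel (tupleStep k) fun x : ι → ℕ => x i ≤ x j :=
  ⟨_, finite_lt_le_pair i j, by simp, tupleStep_mem_lt_le_pair i j⟩

theorem update_tupleStep [DecidableEq ι] (i : ι) (d : ι → Fin k) (e : Fin k) (x : ι → ℕ) (y : ℕ) :
    Function.update (tupleStep k d x) i (digitStep k e y) =
      tupleStep k (Function.update d i e) (Function.update x i y) := by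
  funext j
  by_cases h : j = i
  · subst h; simp [tupleStep]
  · simp [tupleStep, h]

theorem HasFiniteKernel.exists_update [DecidableEq ι] (hk : 0 < k) {f : (ι → ℕ) → Prop}
    (hf : HasFiniteKernel (tupleStep k) f) (i : ι) :
    HasFiniteKernel (tupleStep k) fun x => ∃ y, f (Function.update x i y) := by
  obtain ⟨F, hF, hfF, hclosed⟩ := hf
  refine ⟨(fun S x => ∃ g ∈ S, ∃ y, g (Function.update x i y)) '' 𝒫 F,
    hF.finite_subsets.image _, ⟨{f}, by simpa using hfF, by simp⟩, ?_⟩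
  rintro _ ⟨S, hS, rfl⟩ d
  refine ⟨{h | ∃ g ∈ S, ∃ e, h = fun x => g (tupleStep k (Function.update d i e) x)}, ?_, ?_⟩
  · rintro _ ⟨g, hg, e, rfl⟩
    exact hclosed g (hS hg) _
  · funext x
    refine propext ⟨?_, ?_⟩
    · rintro ⟨_, ⟨g, hg, e, rfl⟩, y, hy⟩
      exact ⟨g, hg, digitStep k e y, by rwa [update_tupleStep]⟩
    · rintro ⟨g, hg, y, hy⟩
      obtain ⟨e, y, rfl⟩ := exists_digitStep_eq hk y
      exact ⟨_, ⟨g, hg, e, rfl⟩, y, by rwa [update_tupleStep] at hy⟩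

theorem HasFiniteKernel.forall_update [DecidableEq ι] (hk : 0 < k) {f : (ι → ℕ) → Prop}
    (hf : HasFiniteKernel (tupleStep k) f) (i : ι) :
    HasFiniteKernel (tupleStep k) fun x => ∀ y, f (Function.update x i y) := by
  simpa using ((hf.map Not).exists_update hk i).map Not

end Tuples

/-- Among all factors of `a` of length `n + 1`, the one at position `i` is least for the
modified order. -/
def IsLeastFactorAt {Δ : Type*} [LinearOrder Δ] (ψ : ℕ → Equiv.Perm Δ) (a : ℕ → Δ)
    (n i : ℕ) : Prop :=
  ∀ j m, m ≤ n → (∀ l, l < m → a (i + l) = a (j + l)) → ψ m (a (i + m)) ≤ ψ m (a (j + m))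

theorem IsLeastFactorAt.apply_eq {Δ : Type*} [LinearOrder Δ] {ψ : ℕ → Equiv.Perm Δ} {a : ℕ → Δ}
    {n i j : ℕ} (hi : IsLeastFactorAt ψ a n i) (hj : IsLeastFactorAt ψ a n j) :
    ∀ m ≤ n, a (i + m) = a (j + m) := by
  intro m
  induction m using Nat.strong_induction_on with
  | _ m ih =>
    intro hm
    have hlt : ∀ l, l < m → a (i + l) = a (j + l) := fun l hl => ih l hl (hl.le.trans hm)
    exact (ψ m).injective
      (le_antisymm (hi j m hm hlt) (hj i m hm fun l hl => (hlt l hl).symm))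

theorem inOrbitClosure_shift {Δ : Type*} (a : ℕ → Δ) (j : ℕ) :
    InOrbitClosure a fun m => a (j + m) :=
  fun _ => ⟨j, fun _ _ => rfl⟩

theorem isLeastFactorAt_of_prefix {Δ : Type*} [LinearOrder Δ] {ψ : ℕ → Equiv.Perm Δ}
    {a b : ℕ → Δ} (hleast : ∀ c : ℕ → Δ, InOrbitClosure a c → PermSeqLexLe ψ b c) {n i : ℕ}
    (hi : ∀ m, m < n + 1 → b m = a (i + m)) : IsLeastFactorAt ψ a n i := by
  intro j m hm hagree
  rw [← hi m (by omega)]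
  rcases hleast _ (inOrbitClosure_shift a j) with heq | ⟨p, heq, hlt⟩
  · exact (congrFun heq m).le
  · rcases lt_trichotomy m p with h | rfl | h
    · exact (heq m h).le
    · exact hlt.le
    · refine absurd hlt (not_lt.mpr ?_)
      simp only [hi p (by omega), hagree p h, le_refl]

theorem apply_eq_iff_exists_isLeastFactorAt {Δ : Type*} [LinearOrder Δ] {ψ : ℕ → Equiv.Perm Δ}
    {a b : ℕ → Δ} (hb : InOrbitClosure a b)
    (hleast : ∀ c : ℕ → Δ, InOrbitClosure a c → PermSeqLexLe ψ b c) (n : ℕ) (c : Δ) :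
    b n = c ↔ ∃ i, IsLeastFactorAt ψ a n i ∧ a (i + n) = c := by
  obtain ⟨i, hi⟩ := hb (n + 1)
  have hmin := isLeastFactorAt_of_prefix hleast hi
  rw [hi n (by omega)]
  refine ⟨fun h => ⟨i, hmin, h⟩, ?_⟩
  rintro ⟨j, hj, rfl⟩
  exact hmin.apply_eq hj n le_rfl

theorem hasFiniteKernel_isLeastFactorAt {Δ : Type*} [LinearOrder Δ] {k : ℕ} (hk : 0 < k)
    {ψ : ℕ → Equiv.Perm Δ} {a : ℕ → Δ} (hψ : HasFiniteKernel (digitStep k) ψ)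
    (ha : HasFiniteKernel (digitStep k) a) :
    HasFiniteKernel (tupleStep k) fun x : Fin 5 → ℕ => IsLeastFactorAt ψ a (x 0) (x 1) := by
  have hagree : HasFiniteKernel (tupleStep k) fun x : Fin 5 → ℕ =>
      ∀ l, l < x 3 → a (x 1 + l) = a (x 2 + l) := by
    simpa using ((hasFiniteKernel_lt (ι := Fin 5) 4 3).map₂
      ((ha.apply_add 1 4).map₂ (ha.apply_add 2 4) Eq) (fun p q => p → q)).forall_update hk 4
  have hle : HasFiniteKernel (tupleStep k) fun x : Fin 5 → ℕ =>
      ψ (x 3) (a (x 1 + x 3)) ≤ ψ (x 3) (a (x 2 + x 3)) :=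
    ((hψ.apply_coord 3).map₂ (ha.apply_add 1 3) fun σ s => σ s).map₂
      ((hψ.apply_coord 3).map₂ (ha.apply_add 2 3) fun σ s => σ s) (· ≤ ·)
  simpa [IsLeastFactorAt] using (((hasFiniteKernel_le (ι := Fin 5) 3 0).map₂
    (hagree.map₂ hle fun p q => p → q) (fun p q => p → q)).forall_update hk 3).forall_update hk 2

/-- If `(ψ_i)` is a `k`-automatic sequence of permutations of `Δ` and `a` is a
`k`-automatic sequence over `Δ`, then the least sequence in the orbit closure
of `a` with respect to the modified order induced by `(ψ_i)` is `k`-automatic. -/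
theorem permLexLeast_orbitClosure_automatic {Δ : Type*} [Fintype Δ]
    [LinearOrder Δ] (k : ℕ) (hk : 2 ≤ k) (ψ : ℕ → Equiv.Perm Δ)
    (hψ : IsKAutomatic k ψ) (a b : ℕ → Δ) (ha : IsKAutomatic k a)
    (hb : InOrbitClosure a b)
    (hleast : ∀ c : ℕ → Δ, InOrbitClosure a c → PermSeqLexLe ψ b c) :
    IsKAutomatic k b := by
  have hpos : 0 < k := by omega
  have ha' := ha.hasFiniteKernel hk
  refine HasFiniteKernel.isKAutomatic (HasFiniteKernel.of_fibers fun c => ?_)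
  simp only [apply_eq_iff_exists_isLeastFactorAt hb hleast]
  have hex : HasFiniteKernel (tupleStep k) fun x : Fin 5 → ℕ =>
      ∃ i, IsLeastFactorAt ψ a (x 0) i ∧ a (i + x 0) = c := by
    simpa using ((hasFiniteKernel_isLeastFactorAt hpos (hψ.hasFiniteKernel hk) ha').map₂
      ((ha'.apply_add 1 0).map (· = c)) And).exists_update hpos 1
  exact hex.comp_semiconj (fun n _ => n) (fun d _ => d) fun _ _ => rfl
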